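/- arXiv:2510.27581 — 3 statements merged into one kernel-verified Lean document; each statement's English description precedes it below -/
import Mathlib

section
/- Let N be a positive integer. Let x ∈ 𝕋 and suppose x = b/r + η, where b, r ∈ 𝔽_q[t] are coprime, r is monic nonzero with ⟨r⟩ ≤ q^{N/2}, and η ∈ K_∞ with ⟨η⟩ < (⟨r⟩ · q^{N/2})^{−1}. Then for every ε > 0 there is a constant C = C(q, ε) > 0 (independent of N, x, b, r, η) such that |Σ_{f ∈ 𝔽_q[t], deg f ≤ N} Λ_{N/4}(f) · e(fx) − (μ(r)/φ(r)) · Σ_{f ∈ 𝔽_q[t], deg f ≤ N} e(fη)| ≤ C · q^{N(3/4 + ε)}. -/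
open Polynomial
open scoped Classical

noncomputable section

variable (p : ℕ) [Fact p.Prime] (Fq : Type) [Field Fq] [Fintype Fq] [Algebra (ZMod p) Fq]

/-- `t` as an element of `K∞ = 𝔽_q((1/t))`; the exponent of the Hahn series variable records
the power of `1/t`, so that `res x = x.coeff 1` and `ord x = -x.order`. -/
def Kt : LaurentSeries Fq := HahnSeries.single (-1 : ℤ) 1

/-- The Laurent expansion at infinity of a polynomial. -/
def toK (f : Polynomial Fq) : LaurentSeries Fq := Polynomial.aeval (Kt Fq) f

/-- The additive character `e(x) = exp(2πi · tr(res x)/p)` on `K∞`. -/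
def eC (x : LaurentSeries Fq) : ℂ :=
  Complex.exp (2 * Real.pi * Complex.I *
    ((Algebra.trace (ZMod p) Fq (x.coeff 1)).val : ℂ) / (p : ℂ))

/-- The norm `⟨x⟩ = q^(ord x)` on `K∞` (with `⟨0⟩ = 0`). -/
def Knorm (x : LaurentSeries Fq) : ℝ :=
  if x = 0 then 0 else (Fintype.card Fq : ℝ) ^ (-x.order)

/-- The norm `⟨f⟩ = q^(deg f)` of a polynomial (with `⟨0⟩ = 0`). -/
def pnorm (f : Polynomial Fq) : ℝ :=
  if f = 0 then 0 else (Fintype.card Fq : ℝ) ^ f.natDegree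

/-- The Euler totient function: the number of units of `𝔽_q[t]/(f)`. -/
def phiP (f : Polynomial Fq) : ℕ := Nat.card ((Polynomial Fq ⧸ Ideal.span {f})ˣ)

/-- The Möbius function on `𝔽_q[t]`: `(-1)^(number of distinct monic irreducible factors)`
for squarefree `f`, and `0` otherwise. -/
def muP (f : Polynomial Fq) : ℤ :=
  if Squarefree f then
    (-1) ^ {P : Polynomial Fq | P.Monic ∧ Irreducible P ∧ P ∣ f}.ncard
  else 0

/-- The Ramanujan sum `c_s(f) = Σ_{deg a < deg s, gcd(a,s)=1} e(af/s)`. -/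
def ramanujanC (s f : Polynomial Fq) : ℂ :=
  ∑ᶠ a ∈ {a : Polynomial Fq | a.degree < s.degree ∧ IsCoprime a s},
    eC p Fq (toK Fq (a * f) / toK Fq s)

/-- The truncated Ramanujan expansion `Λ_X(f) = Σ_{g monic squarefree, deg g ≤ X} (μ(g)/φ(g))·c_g(f)`. -/
def LambdaX (X : ℝ) (f : Polynomial Fq) : ℂ :=
  ∑ᶠ g ∈ {g : Polynomial Fq | g.Monic ∧ Squarefree g ∧ (g.natDegree : ℝ) ≤ X},
    ((muP Fq g : ℂ) / (phiP Fq g : ℂ)) * ramanujanC p Fq g f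

variable {Fq}

omit [Fintype Fq] in
lemma phiP_one : phiP Fq 1 = 1 := by
  have : Subsingleton (Fq[X] ⧸ Ideal.span {(1 : Fq[X])}) :=
    Ideal.Quotient.subsingleton_iff.2 Ideal.span_singleton_one
  simp [phiP]

omit [Fintype Fq] in
lemma phiP_mul {f g : Fq[X]} (h : IsCoprime f g) :
    phiP Fq (f * g) = phiP Fq f * phiP Fq g := by
  unfold phiP
  rw [← Ideal.span_singleton_mul_span_singleton, ← Nat.card_prod]
  exact Nat.card_congr ((Units.mapEquiv (Ideal.quotientMulEquivQuotientProd _ _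
    ((Ideal.isCoprime_span_singleton_iff f g).2 h)).toMulEquiv).trans MulEquiv.prodUnits).toEquiv

lemma phiP_irreducible {P : Fq[X]} (h : Irreducible P) :
    phiP Fq P = Fintype.card Fq ^ P.natDegree - 1 := by
  have : (Ideal.span {P}).IsMaximal := PrincipalIdealRing.isMaximal_of_irreducible h
  let _ := Ideal.Quotient.field (Ideal.span {P})
  have hfin : Module.Finite Fq (Fq[X] ⧸ Ideal.span {P}) :=
    (AdjoinRoot.powerBasis h.ne_zero).finite
  rw [phiP, Nat.card_units, Module.natCard_eq_pow_finrank (K := Fq),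
    finrank_quotient_span_eq_natDegree, Nat.card_eq_fintype_card]

lemma phiP_prod {S : Finset Fq[X]} (hS : ∀ P ∈ S, P.Monic ∧ Irreducible P) :
    phiP Fq (∏ P ∈ S, P) = ∏ P ∈ S, (Fintype.card Fq ^ P.natDegree - 1) := by
  induction S using Finset.induction_on with
  | empty => simp [phiP_one]
  | insert P S hP ih =>
    have hP' := hS P (Finset.mem_insert_self P S)
    have hS' := fun Q hQ => hS Q (Finset.mem_insert_of_mem hQ)
    rw [Finset.prod_insert hP, Finset.prod_insert hP, phiP_mul, ih hS', phiP_irreducible hP'.2]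
    refine IsCoprime.prod_right fun Q hQ => ?_
    refine hP'.2.coprime_iff_not_dvd.2 fun hd => hP ?_
    have := eq_of_monic_of_associated hP'.1 (hS' Q hQ).1
      (hP'.2.associated_of_dvd (hS' Q hQ).2 hd)
    rwa [this]

omit [Fintype Fq] in
lemma exists_prod_of_squarefree {r : Fq[X]} (hr : r.Monic) (hs : Squarefree r) :
    ∃ S : Finset Fq[X], (∀ P ∈ S, P.Monic ∧ Irreducible P) ∧ ∏ P ∈ S, P = r := by
  have hnd := (UniqueFactorizationMonoid.squarefree_iff_nodup_normalizedFactors hr.ne_zero).1 hs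
  refine ⟨⟨UniqueFactorizationMonoid.normalizedFactors r, hnd⟩, fun P hP => ?_, ?_⟩
  · have hi := UniqueFactorizationMonoid.irreducible_of_normalized_factor P hP
    refine ⟨?_, hi⟩
    rw [← UniqueFactorizationMonoid.normalize_normalized_factor P hP]
    exact monic_normalize hi.ne_zero
  · rw [Finset.prod_mk, Multiset.map_id',
      UniqueFactorizationMonoid.prod_normalizedFactors_eq hr.ne_zero, hr.normalize_eq_self]

omit [Fintype Fq] in
lemma degree_le_iff_mem_degreeLT {f : Fq[X]} {n : ℕ} :
    f.degree ≤ n ↔ f ∈ degreeLT Fq (n + 1) := by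
  rw [mem_degreeLT, degree_le_iff_coeff_zero, degree_lt_iff_coeff_zero]
  simp

variable (Fq)

lemma finite_degree_le (n : ℕ) : {f : Fq[X] | f.degree ≤ n}.Finite := by
  have : Finite (degreeLT Fq (n + 1)) := Finite.of_equiv _ (degreeLTEquiv Fq (n + 1)).symm.toEquiv
  exact (Set.toFinite (degreeLT Fq (n + 1) : Set Fq[X])).subset fun f hf =>
    degree_le_iff_mem_degreeLT.1 hf

lemma card_degree_le (n : ℕ) :
    (finite_degree_le Fq n).toFinset.card = Fintype.card Fq ^ (n + 1) := by
  have h : {f : Fq[X] | f.degree ≤ n} = (degreeLT Fq (n + 1) : Set Fq[X]) :=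
    Set.ext fun f => degree_le_iff_mem_degreeLT
  rw [← Set.ncard_eq_toFinset_card _ (finite_degree_le Fq n), h]
  change Nat.card (degreeLT Fq (n + 1)) = _
  rw [Nat.card_congr (degreeLTEquiv Fq (n + 1)).toEquiv]
  simp

/-- The totient of a squarefree polynomial of degree `n` is at least `c_δ · q^(n(1-δ))`. -/
lemma exists_le_phiP {δ : ℝ} (hδ : 0 < δ) :
    ∃ c : ℝ, 0 < c ∧ ∀ r : Fq[X], r.Monic → Squarefree r →
      c * (Fintype.card Fq : ℝ) ^ ((r.natDegree : ℝ) * (1 - δ)) ≤ phiP Fq r := by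
  set q : ℝ := (Fintype.card Fq : ℝ) with hq
  have hq2 : 2 ≤ q := by
    have : 1 < Fintype.card Fq := Fintype.one_lt_card
    rw [hq]; exact_mod_cast this
  have hq0 : 0 < q := by linarith
  obtain ⟨D, hD⟩ : ∃ D : ℕ, 1 / δ < D := exists_nat_gt _
  set B := (finite_degree_le Fq D).toFinset
  set w : Fq[X] → ℝ := fun P => if P ∈ B then 1 / 2 else 1 with hw
  refine ⟨(1 / 2) ^ B.card, by positivity, fun r hr hs => ?_⟩
  obtain ⟨S, hS, rfl⟩ := exists_prod_of_squarefree hr hs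
  have hlocal : ∀ P ∈ S,
      w P * q ^ ((P.natDegree : ℝ) * (1 - δ)) ≤ ((Fintype.card Fq ^ P.natDegree - 1 : ℕ) : ℝ) := by
    intro P hP
    have hd : 1 ≤ P.natDegree := (hS P hP).2.natDegree_pos
    have hqd : 2 ≤ q ^ P.natDegree :=
      hq2.trans (le_self_pow₀ (by linarith) (by omega))
    have hcast : ((Fintype.card Fq ^ P.natDegree - 1 : ℕ) : ℝ) = q ^ P.natDegree - 1 := by
      rw [Nat.cast_sub (Nat.one_le_pow _ _ Fintype.card_pos)]
      simp [hq]
    have hsplit : q ^ ((P.natDegree : ℝ) * (1 - δ)) * q ^ ((P.natDegree : ℝ) * δ)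
        = q ^ P.natDegree := by
      rw [← Real.rpow_add hq0, ← Real.rpow_natCast]
      ring_nf
    have hpos : 0 < q ^ ((P.natDegree : ℝ) * (1 - δ)) := by positivity
    rw [hcast]
    by_cases hPB : P ∈ B
    · have h1 : 1 ≤ q ^ ((P.natDegree : ℝ) * δ) :=
        Real.one_le_rpow (by linarith) (by positivity)
      simp only [hw, hPB, if_true]
      nlinarith
    · have h2 : 2 ≤ q ^ ((P.natDegree : ℝ) * δ) := by
        have hlt : D < P.natDegree := by
          by_contra! hle
          refine hPB ((Set.Finite.mem_toFinset _).2 ?_)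
          exact degree_le_of_natDegree_le hle
        have hlt' : (D : ℝ) < P.natDegree := by exact_mod_cast hlt
        have : 1 ≤ (P.natDegree : ℝ) * δ := by
          have := (div_lt_iff₀ hδ).1 hD
          nlinarith
        calc (2 : ℝ) ≤ q ^ (1 : ℝ) := by simpa using hq2
          _ ≤ _ := Real.rpow_le_rpow_of_exponent_le (by linarith) this
      simp only [hw, hPB, if_false]
      nlinarith
  have hwprod : (1 / 2 : ℝ) ^ B.card ≤ ∏ P ∈ S, w P := by
    rw [hw, Finset.prod_ite, Finset.prod_const, Finset.prod_const_one, mul_one]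
    refine pow_le_pow_of_le_one (by norm_num) (by norm_num) (Finset.card_le_card fun P hP => ?_)
    exact (Finset.mem_filter.1 hP).2
  rw [phiP_prod hS, natDegree_prod_of_monic _ _ fun P hP => (hS P hP).1, Nat.cast_prod]
  calc _ ≤ (∏ P ∈ S, w P) * q ^ (((∑ P ∈ S, P.natDegree : ℕ) : ℝ) * (1 - δ)) := by gcongr
    _ = ∏ P ∈ S, w P * q ^ ((P.natDegree : ℝ) * (1 - δ)) := by
      rw [Finset.prod_mul_distrib, Nat.cast_sum, Finset.sum_mul, Real.rpow_sum_of_pos hq0]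
    _ ≤ _ := Finset.prod_le_prod (fun P _ => by simp only [hw]; split_ifs <;> positivity) hlocal

omit [Fintype Fq] in
lemma norm_muP_le (r : Fq[X]) : ‖(muP Fq r : ℂ)‖ ≤ 1 := by
  unfold muP
  split_ifs <;> simp

section Laurent

variable {Fq}

omit [Fintype Fq]

lemma toK_add (f g : Fq[X]) : toK Fq (f + g) = toK Fq f + toK Fq g := map_add _ f g

lemma toK_mul (f g : Fq[X]) : toK Fq (f * g) = toK Fq f * toK Fq g := map_mul _ f g

lemma toK_monomial (n : ℕ) (a : Fq) :
    toK Fq (monomial n a) = HahnSeries.single (-(n : ℤ)) a := by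
  have h : algebraMap Fq (LaurentSeries Fq) a = HahnSeries.C a := by
    simp [HahnSeries.algebraMap_apply']
  rw [toK, aeval_monomial, Kt, HahnSeries.single_pow, h, HahnSeries.C_apply,
    HahnSeries.single_mul_single]
  simp

lemma coeff_toK_of_pos (f : Fq[X]) {j : ℤ} (hj : 0 < j) : (toK Fq f).coeff j = 0 := by
  induction f using Polynomial.induction_on' with
  | add f g hf hg => rw [toK_add, HahnSeries.coeff_add, hf, hg, add_zero]
  | monomial n a =>
    rw [toK_monomial, HahnSeries.coeff_single_of_ne]
    omega

lemma coeff_toK_neg (f : Fq[X]) (n : ℕ) : (toK Fq f).coeff (-(n : ℤ)) = f.coeff n := by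
  induction f using Polynomial.induction_on' with
  | add f g hf hg => rw [toK_add, HahnSeries.coeff_add, hf, hg, coeff_add]
  | monomial m a =>
    rw [toK_monomial, coeff_monomial]
    by_cases h : m = n
    · simp [h]
    · rw [HahnSeries.coeff_single_of_ne (by omega), if_neg h]

lemma toK_ne_zero {f : Fq[X]} (hf : f ≠ 0) : toK Fq f ≠ 0 := by
  intro h
  have := coeff_toK_neg f f.natDegree
  rw [h, HahnSeries.coeff_zero] at this
  exact hf (leadingCoeff_eq_zero.1 this.symm)

lemma order_toK {f : Fq[X]} (hf : f ≠ 0) : (toK Fq f).order = -(f.natDegree : ℤ) := by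
  refine le_antisymm (HahnSeries.order_le_of_coeff_ne_zero ?_)
    ((HahnSeries.le_order_iff_forall (toK_ne_zero hf)).2 fun j hj => ?_)
  · rw [coeff_toK_neg]
    exact leadingCoeff_ne_zero.2 hf
  · obtain ⟨m, rfl⟩ : ∃ m : ℕ, j = -(m : ℤ) := ⟨j.natAbs, by omega⟩
    rw [coeff_toK_neg]
    exact coeff_eq_zero_of_natDegree_lt (by omega)

/-- A fraction which is not a polynomial, perturbed by a series of small norm, has a nonzero
coefficient of small positive index. -/
lemma exists_coeff_ne_zero {h m : Fq[X]} (hm : m ≠ 0) (hd : ¬ m ∣ h) {η : LaurentSeries Fq}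
    (hη : ∀ j : ℤ, j ≤ m.natDegree → η.coeff j = 0) :
    ∃ j : ℕ, j < m.natDegree ∧ (toK Fq h / toK Fq m + η).coeff (j + 1) ≠ 0 := by
  have hs : h % m ≠ 0 := fun h0 => hd ((EuclideanDomain.mod_eq_zero).1 h0)
  have hlt : (h % m).natDegree < m.natDegree := by
    refine natDegree_lt_natDegree hs ?_
    exact EuclideanDomain.mod_lt h hm
  have hm' := toK_ne_zero hm
  have hs' := toK_ne_zero hs
  have hfrac : toK Fq h / toK Fq m = toK Fq (h / m) + toK Fq (h % m) / toK Fq m := by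
    rw [div_eq_iff hm', add_mul, div_mul_cancel₀ _ hm', ← toK_mul, ← toK_add, mul_comm,
      EuclideanDomain.div_add_mod]
  have hne : toK Fq (h % m) / toK Fq m ≠ 0 := div_ne_zero hs' hm'
  have hord : (toK Fq (h % m) / toK Fq m).order = (m.natDegree : ℤ) - (h % m).natDegree := by
    have := HahnSeries.order_mul hne hm'
    rw [div_mul_cancel₀ _ hm', order_toK hs, order_toK hm] at this
    linarith
  refine ⟨m.natDegree - (h % m).natDegree - 1, by omega, ?_⟩
  have hj : ((m.natDegree - (h % m).natDegree - 1 : ℕ) : ℤ) + 1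
      = (toK Fq (h % m) / toK Fq m).order := by
    rw [hord]; omega
  rw [hj, hfrac, HahnSeries.coeff_add, HahnSeries.coeff_add, coeff_toK_of_pos _ (by omega),
    hη _ (by omega), zero_add, add_zero]
  exact fun h0 => hne (HahnSeries.coeff_order_eq_zero.1 h0)

end Laurent

section Character

variable {Fq}

omit [Fintype Fq] in
lemma eC_eq_stdAddChar (x : LaurentSeries Fq) :
    eC p Fq x = ZMod.stdAddChar (Algebra.trace (ZMod p) Fq (x.coeff 1)) := by
  have h := ZMod.stdAddChar_coe (N := p) ((Algebra.trace (ZMod p) Fq (x.coeff 1)).val : ℤ)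
  rw [eC]
  simpa using h.symm

omit [Fintype Fq] in
lemma eC_add (x y : LaurentSeries Fq) : eC p Fq (x + y) = eC p Fq x * eC p Fq y := by
  simp only [eC_eq_stdAddChar, HahnSeries.coeff_add, map_add, AddChar.map_add_eq_mul]

omit [Fintype Fq] in
lemma norm_eC (x : LaurentSeries Fq) : ‖eC p Fq x‖ = 1 := by
  rw [eC_eq_stdAddChar, ZMod.stdAddChar_apply, Circle.norm_coe]

omit [Fintype Fq] in
lemma eC_toK (f : Fq[X]) : eC p Fq (toK Fq f) = 1 := by
  rw [eC_eq_stdAddChar, coeff_toK_of_pos f one_pos, map_zero, AddChar.map_zero_eq_one]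

/-- Orthogonality: the exponential sum over `deg f ≤ N` vanishes as soon as one of the first
`N + 1` fractional coefficients is nonzero. -/
lemma sum_eC_eq_zero {N j : ℕ} (hj : j ≤ N) {y : LaurentSeries Fq}
    (hy : y.coeff (j + 1) ≠ 0) :
    ∑ f ∈ (finite_degree_le Fq N).toFinset, eC p Fq (toK Fq f * y) = 0 := by
  obtain ⟨u, hu⟩ := Algebra.trace_surjective (ZMod p) Fq 1
  set h : Fq[X] := monomial j (u / y.coeff (j + 1)) with hh
  have hdeg : h.degree ≤ N := (degree_monomial_le _ _).trans (by exact_mod_cast hj)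
  have hne : eC p Fq (toK Fq h * y) ≠ 1 := by
    have hc : (toK Fq h * y).coeff 1 = u := by
      rw [hh, toK_monomial, HahnSeries.coeff_single_mul, sub_neg_eq_add, add_comm (1 : ℤ),
        div_mul_cancel₀ _ hy]
    rw [eC_eq_stdAddChar, hc, hu, ← AddChar.map_zero_eq_one (ZMod.stdAddChar (N := p)),
      ZMod.injective_stdAddChar.ne_iff]
    exact one_ne_zero
  have hshift : ∑ f ∈ (finite_degree_le Fq N).toFinset, eC p Fq (toK Fq f * y)
      = eC p Fq (toK Fq h * y) *
        ∑ f ∈ (finite_degree_le Fq N).toFinset, eC p Fq (toK Fq f * y) := by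
    rw [Finset.mul_sum]
    symm
    refine Finset.sum_equiv (Equiv.addLeft h) (fun f => ?_) fun f _ => ?_
    · simp only [Set.Finite.mem_toFinset, Set.mem_ofPred_eq, Equiv.coe_addLeft]
      refine ⟨fun hf => degree_add_le_of_degree_le hdeg hf, fun hf => ?_⟩
      simpa using degree_sub_le_of_le hf hdeg
    · rw [Equiv.coe_addLeft, toK_add, add_mul, eC_add]
  by_contra hS
  exact hne (mul_right_cancel₀ hS (by rw [one_mul]; exact hshift.symm))

lemma finite_coprime_residues (g : Fq[X]) :
    {a : Fq[X] | a.degree < g.degree ∧ IsCoprime a g}.Finite :=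
  (finite_degree_le Fq g.natDegree).subset fun _ ha => ha.1.le.trans degree_le_natDegree

omit [Fintype Fq] in
lemma exists_neg_residue {b r : Fq[X]} (hbr : IsCoprime b r) (hr : r.Monic) :
    ∃ a : Fq[X], (a.degree < r.degree ∧ IsCoprime a r) ∧ r ∣ a + b := by
  have hd : r ∣ (-b) % r + b := by
    refine ⟨-((-b) / r), ?_⟩
    have := EuclideanDomain.div_add_mod (-b) r
    linear_combination this
  refine ⟨(-b) % r, ⟨EuclideanDomain.mod_lt _ hr.ne_zero, ?_⟩, hd⟩
  obtain ⟨k, hk⟩ := hd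
  have : (-b) % r = -b + r * k := by linear_combination hk
  rw [this]
  exact hbr.neg_left.add_mul_left_left k

/-- The exponential sum twisted by a Ramanujan sum isolates the modulus `g = r`. -/
lemma sum_ramanujanC_mul_eC {N : ℕ} {g r b : Fq[X]} {η : LaurentSeries Fq}
    (hg : g.Monic) (hr : r.Monic) (hbr : IsCoprime b r)
    (hN : g.natDegree + r.natDegree ≤ N)
    (hη : ∀ j : ℤ, j ≤ g.natDegree + r.natDegree → η.coeff j = 0) :
    ∑ f ∈ (finite_degree_le Fq N).toFinset,
        ramanujanC p Fq g f * eC p Fq (toK Fq f * (toK Fq b / toK Fq r + η)) =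
      if g = r then ∑ f ∈ (finite_degree_le Fq N).toFinset, eC p Fq (toK Fq f * η) else 0 := by
  have hg' := toK_ne_zero hg.ne_zero
  have hr' := toK_ne_zero hr.ne_zero
  have hterm : ∀ a f : Fq[X],
      eC p Fq (toK Fq (a * f) / toK Fq g) * eC p Fq (toK Fq f * (toK Fq b / toK Fq r + η)) =
        eC p Fq (toK Fq f * (toK Fq (a * r + b * g) / toK Fq (g * r) + η)) := by
    intro a f
    rw [← eC_add]
    congr 1
    simp only [toK_add, toK_mul]
    field_simp
    ring
  have hexp : ∑ f ∈ (finite_degree_le Fq N).toFinset,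
        ramanujanC p Fq g f * eC p Fq (toK Fq f * (toK Fq b / toK Fq r + η)) =
      ∑ a ∈ (finite_coprime_residues g).toFinset, ∑ f ∈ (finite_degree_le Fq N).toFinset,
        eC p Fq (toK Fq f * (toK Fq (a * r + b * g) / toK Fq (g * r) + η)) := by
    rw [Finset.sum_comm]
    refine Finset.sum_congr rfl fun f _ => ?_
    rw [ramanujanC, finsum_mem_eq_finite_toFinset_sum _ (finite_coprime_residues g),
      Finset.sum_mul]
    exact Finset.sum_congr rfl fun a _ => hterm a f
  have hdeg : (g * r).natDegree = g.natDegree + r.natDegree := hg.natDegree_mul hr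
  have hvanish : ∀ a, ¬ g * r ∣ a * r + b * g → ∑ f ∈ (finite_degree_le Fq N).toFinset,
        eC p Fq (toK Fq f * (toK Fq (a * r + b * g) / toK Fq (g * r) + η)) = 0 := by
    intro a ha
    obtain ⟨j, hj, hc⟩ := exists_coeff_ne_zero (hg.mul hr).ne_zero ha
      (η := η) (fun j hj => hη j (by rw [hdeg] at hj; exact_mod_cast hj))
    exact sum_eC_eq_zero p (by omega) hc
  rw [hexp]
  split_ifs with hgr
  · subst hgr
    obtain ⟨a₀, ha₀, hd⟩ := exists_neg_residue hbr hr
    rw [Finset.sum_eq_single_of_mem a₀ ((Set.Finite.mem_toFinset _).2 ha₀)]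
    · obtain ⟨k, hk⟩ := hd
      refine Finset.sum_congr rfl fun f _ => ?_
      have : toK Fq f * (toK Fq (a₀ * g + b * g) / toK Fq (g * g) + η)
          = toK Fq (f * k) + toK Fq f * η := by
        rw [← add_mul, hk]
        simp only [toK_mul]
        field_simp
      rw [this, eC_add, eC_toK, one_mul]
    · intro a ha hne
      refine hvanish a fun hdvd => hne ?_
      rw [← add_mul] at hdvd
      have h1 : g ∣ a + b := (mul_dvd_mul_iff_right hg.ne_zero).1 hdvd
      have h2 : g ∣ a - a₀ := by simpa using dvd_sub h1 hd
      have h3 : (a - a₀).degree < g.degree :=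
        (degree_sub_le _ _).trans_lt (max_lt ((Set.Finite.mem_toFinset _).1 ha).1 ha₀.1)
      exact sub_eq_zero.1 (eq_zero_of_dvd_of_degree_lt h2 h3)
  · refine Finset.sum_eq_zero fun a ha => hvanish a fun hdvd => hgr ?_
    have hag := ((Set.Finite.mem_toFinset _).1 ha).2
    have h1 : g ∣ a * r :=
      (dvd_add_left (dvd_mul_left g b)).1 ((dvd_mul_right g r).trans hdvd)
    have h2 : r ∣ b * g :=
      (dvd_add_right (dvd_mul_left r a)).1 ((dvd_mul_left r g).trans hdvd)
    exact eq_of_monic_of_associated hg hr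
      (associated_of_dvd_dvd (hag.symm.dvd_of_dvd_mul_left h1) (hbr.symm.dvd_of_dvd_mul_left h2))

end Character

lemma coeff_eq_zero_of_Knorm_lt {η : LaurentSeries Fq} {s : ℝ}
    (h : Knorm Fq η < ((Fintype.card Fq : ℝ) ^ s)⁻¹) {j : ℤ} (hj : (j : ℝ) ≤ s) :
    η.coeff j = 0 := by
  rw [Knorm] at h
  split_ifs at h with h0
  · rw [h0, HahnSeries.coeff_zero]
  · have hq : (1 : ℝ) < Fintype.card Fq := by exact_mod_cast Fintype.one_lt_card (α := Fq)
    rw [← Real.rpow_neg (by positivity), ← Real.rpow_intCast,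
      Real.rpow_lt_rpow_left_iff hq] at h
    refine HahnSeries.coeff_eq_zero_of_lt_order ?_
    push_cast at h
    have : (j : ℝ) < η.order := by linarith
    exact_mod_cast this

lemma finite_LambdaX_index {X : ℝ} {N : ℕ} (hX : X ≤ N) :
    {g : Fq[X] | g.Monic ∧ Squarefree g ∧ (g.natDegree : ℝ) ≤ X}.Finite :=
  (finite_degree_le Fq N).subset fun g hg =>
    degree_le_of_natDegree_le (by exact_mod_cast hg.2.2.trans hX)

/-- On a major arc the exponential sum of `Λ_X` is exactly the main term when `r` occurs among
the moduli of `Λ_X`, and is zero otherwise. -/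
lemma sum_LambdaX_mul_eC {X : ℝ} {N : ℕ} (hX : X ≤ N) {r b : Fq[X]} {η : LaurentSeries Fq}
    (hr : r.Monic) (hbr : IsCoprime b r) (hN : X + r.natDegree ≤ N)
    (hη : ∀ j : ℤ, (j : ℝ) ≤ X + r.natDegree → η.coeff j = 0) :
    ∑ f ∈ (finite_degree_le Fq N).toFinset,
        LambdaX p Fq X f * eC p Fq (toK Fq f * (toK Fq b / toK Fq r + η)) =
      if Squarefree r ∧ (r.natDegree : ℝ) ≤ X then
        (muP Fq r : ℂ) / (phiP Fq r : ℂ) *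
          ∑ f ∈ (finite_degree_le Fq N).toFinset, eC p Fq (toK Fq f * η)
      else 0 := by
  have hG := finite_LambdaX_index Fq hX
  have hexp : ∑ f ∈ (finite_degree_le Fq N).toFinset,
        LambdaX p Fq X f * eC p Fq (toK Fq f * (toK Fq b / toK Fq r + η)) =
      ∑ g ∈ hG.toFinset, if g = r then (muP Fq g : ℂ) / (phiP Fq g : ℂ) *
          ∑ f ∈ (finite_degree_le Fq N).toFinset, eC p Fq (toK Fq f * η) else 0 := by
    simp only [LambdaX, finsum_mem_eq_finite_toFinset_sum _ hG, Finset.sum_mul]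
    rw [Finset.sum_comm]
    refine Finset.sum_congr rfl fun g hg => ?_
    obtain ⟨hgm, -, hgX⟩ := (Set.Finite.mem_toFinset _).1 hg
    simp only [mul_assoc]
    rw [← Finset.mul_sum, sum_ramanujanC_mul_eC p hgm hr hbr, mul_ite, mul_zero]
    · have : ((g.natDegree + r.natDegree : ℕ) : ℝ) ≤ N := by push_cast; linarith
      exact_mod_cast this
    · intro j hj
      refine hη j ?_
      have : (j : ℝ) ≤ g.natDegree + r.natDegree := by exact_mod_cast hj
      linarith
  rw [hexp, Finset.sum_ite_eq']
  simp [hr]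

/-- Major arc estimate for the truncated Ramanujan expansion `Λ_{N/4}`: if `x = b/r + η` with
`(b,r) = 1`, `r` monic, `⟨r⟩ ≤ q^(N/2)` and `⟨η⟩ < (⟨r⟩q^(N/2))⁻¹`, then
`|Σ_{deg f ≤ N} Λ_{N/4}(f)e(fx) − (μ(r)/φ(r))·Σ_{deg f ≤ N} e(fη)| ≤ C(q,ε)·q^(N(3/4+ε))`. -/
theorem LambdaX_major_arc_estimate (ε : ℝ) (hε : 0 < ε) :
    ∃ C : ℝ, 0 < C ∧
      ∀ (N : ℕ) (x η : LaurentSeries Fq) (b r : Polynomial Fq),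
        0 < N →
        Knorm Fq x < 1 →
        IsCoprime b r → r.Monic →
        pnorm Fq r ≤ (Fintype.card Fq : ℝ) ^ ((N : ℝ) / 2) →
        Knorm Fq η < (pnorm Fq r * (Fintype.card Fq : ℝ) ^ ((N : ℝ) / 2))⁻¹ →
        x = toK Fq b / toK Fq r + η →
        ‖(∑ᶠ f ∈ {f : Polynomial Fq | f.degree ≤ (N : ℕ)},
            LambdaX p Fq ((N : ℝ) / 4) f * eC p Fq (toK Fq f * x)) -
          ((muP Fq r : ℂ) / (phiP Fq r : ℂ)) *
            ∑ᶠ f ∈ {f : Polynomial Fq | f.degree ≤ (N : ℕ)}, eC p Fq (toK Fq f * η)‖ ≤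
          C * (Fintype.card Fq : ℝ) ^ ((N : ℝ) * (3 / 4 + ε)) := by
  set q : ℝ := (Fintype.card Fq : ℝ) with hq
  have hq1 : 1 < q := by rw [hq]; exact_mod_cast Fintype.one_lt_card (α := Fq)
  have hq0 : 0 < q := by linarith
  obtain ⟨c, hc, hphi⟩ := exists_le_phiP Fq (lt_min hε one_pos)
  refine ⟨q / c, by positivity, ?_⟩
  rintro N x η b r - - hbr hr hrN hη rfl
  have hpn : pnorm Fq r = q ^ (r.natDegree : ℝ) := by
    rw [pnorm, if_neg hr.ne_zero, Real.rpow_natCast]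
  rw [hpn, Real.rpow_le_rpow_left_iff hq1] at hrN
  rw [hpn, ← Real.rpow_add hq0] at hη
  have hN0 : (0 : ℝ) ≤ N := Nat.cast_nonneg N
  rw [finsum_mem_eq_finite_toFinset_sum _ (finite_degree_le Fq N),
    finsum_mem_eq_finite_toFinset_sum _ (finite_degree_le Fq N),
    sum_LambdaX_mul_eC p Fq (by linarith) hr hbr (by linarith)
      fun j hj => coeff_eq_zero_of_Knorm_lt Fq hη (by linarith)]
  split_ifs with h
  · rw [sub_self, norm_zero]
    positivity
  by_cases hs : Squarefree r
  · have hn : (N : ℝ) / 4 ≤ r.natDegree := not_le.1 (fun h' => h ⟨hs, h'⟩) |>.le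
    have hsum : ‖∑ f ∈ (finite_degree_le Fq N).toFinset, eC p Fq (toK Fq f * η)‖
        ≤ q ^ (N : ℝ) * q := by
      refine (norm_sum_le _ _).trans_eq ?_
      simp only [norm_eC, Finset.sum_const, card_degree_le, nsmul_eq_mul, mul_one]
      rw [Real.rpow_natCast, ← pow_succ, Nat.cast_pow]
    have hlow : c * q ^ ((N : ℝ) / 4 - N * ε) ≤ phiP Fq r := by
      refine le_trans ?_ (hphi r hr hs)
      gcongr
      · exact hq1.le
      · have h1 : 0 ≤ 1 - min ε 1 := sub_nonneg.2 (min_le_right _ _)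
        have h2 := min_le_left ε 1
        nlinarith [mul_le_mul_of_nonneg_right hn h1, mul_le_mul_of_nonneg_left h2 hN0,
          mul_nonneg hN0 hε.le]
    have hpos : 0 < c * q ^ ((N : ℝ) / 4 - N * ε) := by positivity
    rw [zero_sub, norm_neg, norm_mul, norm_div, Complex.norm_natCast]
    calc _ ≤ 1 / (c * q ^ ((N : ℝ) / 4 - N * ε)) * (q ^ (N : ℝ) * q) := by
          gcongr
          exact norm_muP_le Fq r
      _ = q / c * (q ^ (N : ℝ) / q ^ ((N : ℝ) / 4 - N * ε)) := by field_simp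
      _ = q / c * q ^ ((N : ℝ) * (3 / 4 + ε)) := by
          rw [← Real.rpow_sub hq0]
          ring_nf
  · have : muP Fq r = 0 := if_neg hs
    rw [this]
    simp only [Int.cast_zero, zero_div, zero_mul, sub_zero, norm_zero]
    positivity

end
end

section
/- Let d, r, s ∈ 𝔽_q[t] be nonzero with d monic, and let b ∈ 𝔽_q[t] with gcd(b, r) = 1. Then the number of polynomials a ∈ 𝔽_q[t] with deg a < deg s such that denom(a/s + b/r) = d is at most ⟨d⟩ · ⟨(r,s)⟩ / ⟨r⟩, where (r,s) denotes the monic greatest common divisor of r and s. -/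
open Polynomial
open scoped Classical

noncomputable section

variable (Fq : Type) [Field Fq] [Fintype Fq]

theorem ncard_degree_lt {K : Type*} [Field K] [Fintype K] (n : ℕ) :
    {k : Polynomial K | k.degree < n}.ncard = Fintype.card K ^ n := by
  have h : {k : Polynomial K | k.degree < n} = (degreeLT K n : Set (Polynomial K)) := by
    ext k
    simp [mem_degreeLT]
  rw [h, ← Nat.card_coe_set_eq]
  refine (Nat.card_congr (degreeLTEquiv K n).toEquiv).trans ?_
  simp

theorem finite_degree_lt {K : Type*} [Field K] [Fintype K] (n : ℕ) :
    {k : Polynomial K | k.degree < n}.Finite :=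
  Set.finite_of_ncard_ne_zero <| by
    rw [ncard_degree_lt]
    exact pow_ne_zero _ Fintype.card_ne_zero

/-- Clearing denominators in `a / s + b / r`, whose reduced denominator is `d`. -/
theorem exists_mul_eq_of_denom_eq {K : Type*} [Field K]
    {a s b r d : Polynomial K} (hr : r ≠ 0) (hs : s ≠ 0)
    (h : RatFunc.denom
          (algebraMap (Polynomial K) (RatFunc K) a /
              algebraMap (Polynomial K) (RatFunc K) s +
            algebraMap (Polynomial K) (RatFunc K) b /
              algebraMap (Polynomial K) (RatFunc K) r) = d) :
    ∃ c, d * (a * r + b * s) = c * (r * s) := by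
  set x := algebraMap (Polynomial K) (RatFunc K) a / algebraMap (Polynomial K) (RatFunc K) s +
    algebraMap (Polynomial K) (RatFunc K) b / algebraMap (Polynomial K) (RatFunc K) r with hx
  have hd : d ≠ 0 := h ▸ x.denom_ne_zero
  refine ⟨x.num, RatFunc.algebraMap_injective K ?_⟩
  have hr' := RatFunc.algebraMap_ne_zero hr
  have hs' := RatFunc.algebraMap_ne_zero hs
  have hd' := RatFunc.algebraMap_ne_zero hd
  have key := x.num_div_denom
  rw [h, div_eq_iff hd'] at key
  simp only [map_mul, map_add, key]
  rw [hx]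
  field_simp

theorem dvd_sub_of_mul_eq {K : Type*} [Field K]
    {a a₀ s b r d c c₀ : Polynomial K} (hr : r ≠ 0)
    (h : d * (a * r + b * s) = c * (r * s)) (h₀ : d * (a₀ * r + b * s) = c₀ * (r * s)) :
    s ∣ d * (a - a₀) :=
  ⟨c - c₀, mul_left_cancel₀ hr <| by linear_combination h - h₀⟩

theorem natDegree_gcd_add_le {K : Type*} [Field K]
    {a s b r d c : Polynomial K} (hd : d ≠ 0) (hr : r ≠ 0)
    (hbr : IsCoprime b r) (h : d * (a * r + b * s) = c * (r * s)) :
    (gcd d s).natDegree + r.natDegree ≤ d.natDegree + (gcd r s).natDegree := by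
  have hh : gcd d s ≠ 0 := gcd_ne_zero_of_left hd
  have hg : gcd r s ≠ 0 := gcd_ne_zero_of_left hr
  obtain ⟨d₁, hd₁⟩ := gcd_dvd_left d s
  obtain ⟨s₁, hs₁⟩ := gcd_dvd_right d s
  have h₁ : d₁ * (a * r + b * s) = c * (r * s₁) := by
    apply mul_left_cancel₀ hh
    linear_combination h - (a * r + b * s) * hd₁ + c * r * hs₁
  have h₂ : r ∣ b * (d₁ * s) := ⟨c * s₁ - d₁ * a, by linear_combination h₁⟩
  have h₃ : r ∣ d₁ * gcd r s :=
    (dvd_gcd (Dvd.intro_left d₁ rfl) (hbr.symm.dvd_of_dvd_mul_left h₂)).trans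
      (gcd_mul_left' d₁ r s).dvd
  have hd₁0 : d₁ ≠ 0 := by
    rintro rfl
    exact hd (by simpa using hd₁)
  have h₄ := natDegree_le_of_dvd h₃ (mul_ne_zero hd₁0 hg)
  rw [natDegree_mul hd₁0 hg] at h₄
  have h₅ : d.natDegree = (gcd d s).natDegree + d₁.natDegree := by
    conv_lhs => rw [hd₁]
    exact natDegree_mul hh hd₁0
  omega

theorem ncard_le_of_dvd_mul_sub {K : Type*} [Field K] [Fintype K]
    {d s a₀ : Polynomial K} (hs : s ≠ 0) {A : Set (Polynomial K)}
    (ha₀ : a₀.degree < s.degree) (hA : ∀ a ∈ A, a.degree < s.degree ∧ s ∣ d * (a - a₀)) :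
    A.ncard ≤ Fintype.card K ^ (gcd d s).natDegree := by
  have hh : gcd d s ≠ 0 := gcd_ne_zero_of_right hs
  obtain ⟨s₁, hs₁⟩ := gcd_dvd_right d s
  have hs₁0 : s₁ ≠ 0 := by
    rintro rfl
    exact hs (by simpa using hs₁)
  have hsub : A ⊆ (fun k => a₀ + s₁ * k) '' {k | k.degree < (gcd d s).natDegree} := by
    intro a ha
    obtain ⟨hdeg, hdvd⟩ := hA a ha
    have h₁ : s₁ ∣ a - a₀ := by
      have h₂ : s ∣ gcd d s * (a - a₀) :=
        (dvd_gcd hdvd (dvd_mul_right s _)).trans (gcd_mul_right' (a - a₀) d s).dvd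
      rw [hs₁] at h₂
      nth_rewrite 2 [← hs₁] at h₂
      exact (mul_dvd_mul_iff_left hh).1 h₂
    obtain ⟨k, hk⟩ := h₁
    refine ⟨k, ?_, by simp [← hk]⟩
    have hlt : (s₁ * k).degree < (s₁ * gcd d s).degree := by
      rw [← hk, mul_comm, ← hs₁]
      exact (degree_sub_le _ _).trans_lt (max_lt hdeg ha₀)
    rw [degree_mul, degree_mul] at hlt
    rw [Set.mem_ofPred_eq, ← degree_eq_natDegree hh]
    exact lt_of_add_lt_add_left hlt
  calc A.ncard ≤ _ := Set.ncard_le_ncard hsub ((finite_degree_lt _).image _)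
    _ ≤ _ := Set.ncard_image_le (finite_degree_lt _)
    _ = _ := ncard_degree_lt _

/-- Counting residues with prescribed denominator: the number of `a` with `deg a < deg s` and
`denom(a/s + b/r) = d` (`denom` the monic least-degree denominator, i.e. `RatFunc.denom`) is
at most `⟨d⟩·⟨(r,s)⟩/⟨r⟩`. -/
theorem denominator_count (d r s b : Polynomial Fq)
    (hd : d ≠ 0) (hdm : d.Monic) (hr : r ≠ 0) (hs : s ≠ 0) (hbr : IsCoprime b r) :
    ({a : Polynomial Fq | a.degree < s.degree ∧
        RatFunc.denom
          (algebraMap (Polynomial Fq) (RatFunc Fq) a /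
              algebraMap (Polynomial Fq) (RatFunc Fq) s +
            algebraMap (Polynomial Fq) (RatFunc Fq) b /
              algebraMap (Polynomial Fq) (RatFunc Fq) r) = d}.ncard : ℝ) ≤
      pnorm Fq d * pnorm Fq (gcd r s) / pnorm Fq r := by
  have hg : gcd r s ≠ 0 := gcd_ne_zero_of_left hr
  have hq : (0 : ℝ) < Fintype.card Fq := by exact_mod_cast Fintype.card_pos
  simp only [pnorm, if_neg hd, if_neg hr, if_neg hg]
  rw [le_div_iff₀ (pow_pos hq _), ← pow_add]
  set A := {a : Polynomial Fq | a.degree < s.degree ∧ _}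
  rcases A.eq_empty_or_nonempty with hempty | ⟨a₀, hdeg₀, hden₀⟩
  · rw [hempty, Set.ncard_empty, Nat.cast_zero, zero_mul]
    positivity
  · obtain ⟨c₀, hc₀⟩ := exists_mul_eq_of_denom_eq hr hs hden₀
    have hcard : A.ncard ≤ Fintype.card Fq ^ (gcd d s).natDegree := by
      refine ncard_le_of_dvd_mul_sub hs hdeg₀ ?_
      rintro a ⟨hdeg, hden⟩
      obtain ⟨c, hc⟩ := exists_mul_eq_of_denom_eq hr hs hden
      exact ⟨hdeg, dvd_sub_of_mul_eq hr hc hc₀⟩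
    have hdegree := natDegree_gcd_add_le hd hr hbr hc₀
    have hle : A.ncard * Fintype.card Fq ^ r.natDegree ≤
        Fintype.card Fq ^ (d.natDegree + (gcd r s).natDegree) :=
      calc _ ≤ Fintype.card Fq ^ (gcd d s).natDegree * Fintype.card Fq ^ r.natDegree := by gcongr
        _ = Fintype.card Fq ^ ((gcd d s).natDegree + r.natDegree) := (pow_add _ _ _).symm
        _ ≤ _ := Nat.pow_le_pow_right Fintype.card_pos hdegree
    exact_mod_cast hle

end
end

section
/- Let B₁, B₂ ≥ 0. There exist constants C and A, depending only on q, B₁, B₂, with the following property. Let X₁, X₂ > 0, and for i = 1, 2 let cᵢ be a complex-valued function on 𝔽_q(t)/𝔽_q[t] such that cᵢ(λ) = 0 unless the denominator s = denom(λ) is squarefree with deg s ≤ Xᵢ, and such that |cᵢ(λ)| ≤ τ(denom(λ))^{Bᵢ}/⟨denom(λ)⟩ for all λ. Define c(λ) = Σ_{λ₁, λ₂ ∈ 𝔽_q(t)/𝔽_q[t], λ₁ + λ₂ = λ} c₁(λ₁) c₂(λ₂) (a finite sum). Then c(λ) = 0 unless s = denom(λ) is squarefree with deg s ≤ X₁ +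 X₂, and |c(λ)| ≤ C · (X₁ + 1)^A · τ(s)^{B₁ + 2B₂ + 3}/⟨s⟩. -/
open Polynomial
open scoped Classical

noncomputable section

variable (Fq : Type) [Field Fq] [Fintype Fq]

/-- The divisor function: the number of monic divisors of `f`. -/
def tauP (f : Polynomial Fq) : ℕ := {d : Polynomial Fq | d.Monic ∧ d ∣ f}.ncard

/-- `𝔽_q[t]` as an additive subgroup of `𝔽_q(t)`. -/
def polySub : AddSubgroup (RatFunc Fq) :=
  AddMonoidHom.range (algebraMap (Polynomial Fq) (RatFunc Fq)).toAddMonoidHom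

/-- The quotient group `𝔽_q(t)/𝔽_q[t]`. -/
abbrev QT := RatFunc Fq ⧸ polySub Fq

/-- `s` is the denominator of `lam ∈ 𝔽_q(t)/𝔽_q[t]`: some (equivalently, any) representative
of `lam` has reduced monic denominator `s`. -/
def IsDenomQ (lam : QT Fq) (s : Polynomial Fq) : Prop :=
  ∃ μ : RatFunc Fq, QuotientAddGroup.mk' (polySub Fq) μ = lam ∧ RatFunc.denom μ = s

variable {Fq}

theorem ncard_degreeLT (n : ℕ) :
    (degreeLT Fq n : Set Fq[X]).ncard = Fintype.card Fq ^ n := by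
  rw [← Nat.card_coe_set_eq]
  exact (Nat.card_congr (degreeLTEquiv Fq n).toEquiv).trans (by simp)

theorem finite_degreeLT (n : ℕ) : (degreeLT Fq n : Set Fq[X]).Finite :=
  Set.finite_coe_iff.mp (Finite.of_equiv _ (degreeLTEquiv Fq n).toEquiv.symm)

theorem finite_natDegree_le (N : ℕ) : {f : Fq[X] | f.natDegree ≤ N}.Finite := by
  refine (finite_degreeLT (N + 1)).subset fun f hf => ?_
  rw [SetLike.mem_coe, mem_degreeLT]
  exact (degree_le_of_natDegree_le hf).trans_lt (by exact_mod_cast N.lt_succ_self)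

theorem finite_monic_dvd {f : Fq[X]} (hf : f ≠ 0) : {d : Fq[X] | d.Monic ∧ d ∣ f}.Finite :=
  (finite_natDegree_le f.natDegree).subset fun _ hd => natDegree_le_of_dvd hd.2 hf

theorem one_lt_card : (1 : ℝ) < Fintype.card Fq := by
  exact_mod_cast Fintype.one_lt_card

theorem pnorm_pos {f : Fq[X]} (hf : f ≠ 0) : 0 < pnorm Fq f := by
  rw [pnorm, if_neg hf]
  exact pow_pos (zero_lt_one.trans one_lt_card) _

theorem pnorm_mul (f g : Fq[X]) : pnorm Fq (f * g) = pnorm Fq f * pnorm Fq g := by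
  by_cases hf : f = 0
  · simp [pnorm, hf]
  by_cases hg : g = 0
  · simp [pnorm, hg]
  simp [pnorm, hf, hg, natDegree_mul, pow_add]

theorem tauP_mono {f g : Fq[X]} (hg : g ≠ 0) (h : f ∣ g) : tauP Fq f ≤ tauP Fq g :=
  Set.ncard_le_ncard (fun _ hd => ⟨hd.1, hd.2.trans h⟩) (finite_monic_dvd hg)

theorem one_le_tauP {f : Fq[X]} (hf : f ≠ 0) : 1 ≤ tauP Fq f := by
  rw [Nat.one_le_iff_ne_zero, tauP, Ne, Set.ncard_eq_zero (finite_monic_dvd hf)]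
  exact Set.Nonempty.ne_empty ⟨1, monic_one, one_dvd _⟩

theorem tauP_mul_le {f g : Fq[X]} (hf : f ≠ 0) (hg : g ≠ 0) :
    tauP Fq (f * g) ≤ tauP Fq f * tauP Fq g := by
  unfold tauP
  rw [← Set.ncard_prod]
  have hfin := (finite_monic_dvd hf).prod (finite_monic_dvd hg)
  refine le_trans (Set.ncard_le_ncard ?_ (hfin.image fun p => p.1 * p.2))
    (Set.ncard_image_le hfin)
  rintro d ⟨hd, hdvd⟩
  obtain ⟨a, b, ha, hb, rfl⟩ := exists_dvd_and_dvd_of_dvd_mul hdvd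
  have ha0 : a ≠ 0 := left_ne_zero_of_mul hd.ne_zero
  have hb0 : b ≠ 0 := right_ne_zero_of_mul hd.ne_zero
  have hab : a.leadingCoeff * b.leadingCoeff = 1 := by
    rw [← leadingCoeff_mul]; exact hd
  refine ⟨(a * C a.leadingCoeff⁻¹, b * C b.leadingCoeff⁻¹),
    ⟨⟨monic_mul_leadingCoeff_inv ha0, ?_⟩, monic_mul_leadingCoeff_inv hb0, ?_⟩, ?_⟩
  · refine (IsUnit.mul_right_dvd ?_).2 ha
    simpa using ha0
  · refine (IsUnit.mul_right_dvd ?_).2 hb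
    simpa using hb0
  · calc a * C a.leadingCoeff⁻¹ * (b * C b.leadingCoeff⁻¹)
        = a * b * C (a.leadingCoeff * b.leadingCoeff)⁻¹ := by rw [mul_inv, C_mul]; ring
      _ = a * b := by rw [hab]; simp

/-- The monic polynomials of degree at most `N`. -/
def monicsLE (Fq : Type) [Field Fq] [Fintype Fq] (N : ℕ) : Finset Fq[X] :=
  ((finite_natDegree_le (Fq := Fq) N).subset
    (fun _ h => h.2 : {f : Fq[X] | f.Monic ∧ f.natDegree ≤ N} ⊆ _)).toFinset

theorem mem_monicsLE {N : ℕ} {f : Fq[X]} : f ∈ monicsLE Fq N ↔ f.Monic ∧ f.natDegree ≤ N := by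
  simp [monicsLE]

theorem ncard_monic_natDegree_eq (n : ℕ) :
    {f : Fq[X] | f.Monic ∧ f.natDegree = n}.ncard = Fintype.card Fq ^ n := by
  rw [← ncard_degreeLT, ← Nat.card_coe_set_eq, ← Nat.card_coe_set_eq]
  exact Nat.card_congr (monicEquivDegreeLT n)

theorem sum_inv_pnorm_le (N : ℕ) : ∑ e ∈ monicsLE Fq N, 1 / pnorm Fq e ≤ N + 1 := by
  rw [← Finset.sum_fiberwise_of_maps_to (g := natDegree) (t := Finset.range (N + 1))
    (fun e he => by simpa [Nat.lt_succ_iff] using (mem_monicsLE.1 he).2)]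
  refine (Finset.sum_le_card_nsmul _ _ 1 fun n _ => ?_).trans (by simp)
  have hq : (0 : ℝ) < (Fintype.card Fq : ℝ) ^ n := pow_pos (zero_lt_one.trans one_lt_card) _
  refine (Finset.sum_le_card_nsmul _ _ (1 / (Fintype.card Fq : ℝ) ^ n) fun e he => ?_).trans ?_
  · rw [Finset.mem_filter, mem_monicsLE] at he
    rw [pnorm, if_neg he.1.1.ne_zero, he.2]
  · rw [nsmul_eq_mul, mul_one_div, div_le_one hq, ← Set.ncard_coe_finset]
    have hfin : {f : Fq[X] | f.Monic ∧ f.natDegree = n}.Finite :=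
      (finite_natDegree_le n).subset fun f hf => hf.2.le
    have := Set.ncard_le_ncard (s := ({e ∈ monicsLE Fq N | e.natDegree = n} : Finset Fq[X]))
      (fun e he => ?_) hfin
    · rw [ncard_monic_natDegree_eq] at this
      exact_mod_cast this
    · rw [Finset.mem_coe, Finset.mem_filter, mem_monicsLE] at he
      exact ⟨he.1.1, he.2⟩

theorem sum_tauP_pow_div_pnorm_le (N k : ℕ) :
    ∑ e ∈ monicsLE Fq N, (tauP Fq e : ℝ) ^ k / pnorm Fq e ≤ ((N : ℝ) + 1) ^ 2 ^ k := by
  induction k with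
  | zero => simpa using sum_inv_pnorm_le (Fq := Fq) N
  | succ k ih =>
    set S := monicsLE Fq N
    have hnonneg (e : Fq[X]) (he : e ∈ S) : 0 ≤ (tauP Fq e : ℝ) ^ k / pnorm Fq e :=
      div_nonneg (by positivity) (pnorm_pos (mem_monicsLE.1 he).1.ne_zero).le
    have hprod : ∑ p ∈ S ×ˢ S, (tauP Fq p.1 : ℝ) ^ k / pnorm Fq p.1 *
        ((tauP Fq p.2 : ℝ) ^ k / pnorm Fq p.2) ≤ ((N : ℝ) + 1) ^ 2 ^ (k + 1) := by
      rw [Finset.sum_product]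
      dsimp only
      rw [← Finset.sum_mul_sum, pow_succ 2 k, pow_mul, sq]
      exact mul_le_mul ih ih (Finset.sum_nonneg hnonneg) (by positivity)
    refine le_trans ?_ hprod
    calc ∑ e ∈ S, (tauP Fq e : ℝ) ^ (k + 1) / pnorm Fq e
        ≤ ∑ e ∈ S, ∑ p ∈ S ×ˢ S with p.1 * p.2 = e, (tauP Fq p.1 : ℝ) ^ k / pnorm Fq p.1 *
            ((tauP Fq p.2 : ℝ) ^ k / pnorm Fq p.2) := Finset.sum_le_sum fun e he => ?_
      _ ≤ _ := Finset.sum_fiberwise_le_sum_of_sum_fiber_nonneg fun e _ =>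
          Finset.sum_nonneg fun p hp => ?_
    · obtain ⟨hem, heN⟩ := mem_monicsLE.1 he
      have hcard : tauP Fq e ≤ ({p ∈ S ×ˢ S | p.1 * p.2 = e} : Finset _).card := by
        rw [tauP, ← Set.ncard_coe_finset]
        refine Set.ncard_le_ncard_of_injOn (fun d => (d, e / d)) (fun d hd => ?_)
          (fun a _ b _ hab => (Prod.mk.inj hab).1) (Finset.finite_toSet _)
        have hmul : d * (e / d) = e := EuclideanDomain.mul_div_cancel' hd.1.ne_zero hd.2
        have hm : (e / d).Monic := hd.1.of_mul_monic_left (hmul.symm ▸ hem)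
        simp only [Finset.coe_filter, Finset.mem_product, Set.mem_ofPred_eq]
        exact ⟨⟨mem_monicsLE.2 ⟨hd.1, (natDegree_le_of_dvd hd.2 hem.ne_zero).trans heN⟩,
          mem_monicsLE.2 ⟨hm, (natDegree_le_of_dvd ⟨d, by rw [mul_comm, hmul]⟩
            hem.ne_zero).trans heN⟩⟩, hmul⟩
      have hpos := pnorm_pos hem.ne_zero
      calc (tauP Fq e : ℝ) ^ (k + 1) / pnorm Fq e
          = tauP Fq e * ((tauP Fq e : ℝ) ^ k / pnorm Fq e) := by rw [pow_succ]; ring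
        _ ≤ ({p ∈ S ×ˢ S | p.1 * p.2 = e} : Finset _).card *
              ((tauP Fq e : ℝ) ^ k / pnorm Fq e) := by gcongr
        _ ≤ _ := by
          rw [← nsmul_eq_mul]
          refine Finset.card_nsmul_le_sum _ _ _ fun p hp => ?_
          rw [Finset.mem_filter, Finset.mem_product] at hp
          obtain ⟨⟨h1, h2⟩, rfl⟩ := hp
          have h1 := (mem_monicsLE.1 h1).1.ne_zero
          have h2 := (mem_monicsLE.1 h2).1.ne_zero
          rw [div_mul_div_comm, ← pnorm_mul, ← mul_pow]
          gcongr
          exact_mod_cast tauP_mul_le h1 h2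
    · rw [Finset.mem_filter, Finset.mem_product] at hp
      exact mul_nonneg (hnonneg _ hp.1.1) (hnonneg _ hp.1.2)

/-- Multiplication by a polynomial on `𝔽_q(t)/𝔽_q[t]`. -/
def polyMul (f : Fq[X]) : QT Fq →+ QT Fq :=
  QuotientAddGroup.map _ _ (AddMonoidHom.mulLeft (algebraMap Fq[X] (RatFunc Fq) f)) (by
    rintro _ ⟨g, rfl⟩
    exact ⟨f * g, by simp⟩)

theorem polyMul_mk {K : Type} [Field K] (f : K[X]) (μ : RatFunc K) :
    polyMul f (QuotientAddGroup.mk' (polySub K) μ) =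
      QuotientAddGroup.mk' (polySub K) (algebraMap K[X] (RatFunc K) f * μ) := rfl

theorem exists_isDenomQ {K : Type} [Field K] (lam : QT K) : ∃ s, IsDenomQ K lam s := by
  obtain ⟨μ, rfl⟩ := QuotientAddGroup.mk'_surjective _ lam
  exact ⟨_, μ, rfl, rfl⟩

theorem IsDenomQ.monic {K : Type} [Field K]
    {lam : QT K} {s : K[X]} (h : IsDenomQ K lam s) : s.Monic := by
  obtain ⟨μ, -, rfl⟩ := h
  exact RatFunc.monic_denom μ

theorem IsDenomQ.polyMul_eq_zero_iff {K : Type} [Field K]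
    {lam : QT K} {s : K[X]} (h : IsDenomQ K lam s)
    (f : K[X]) : polyMul f lam = 0 ↔ s ∣ f := by
  obtain ⟨μ, rfl, rfl⟩ := h
  rw [polyMul_mk, QuotientAddGroup.mk'_apply, QuotientAddGroup.eq_zero_iff]
  by_cases hf : f = 0
  · simp [hf]
  have hf' : algebraMap K[X] (RatFunc K) f ≠ 0 := RatFunc.algebraMap_ne_zero hf
  rw [RatFunc.denom_dvd hf]
  refine exists_congr fun p => ?_
  rw [eq_div_iff hf', mul_comm μ, eq_comm]
  rfl

theorem IsDenomQ.unique {K : Type} [Field K] {lam : QT K} {s s' : K[X]} (h : IsDenomQ K lam s)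
    (h' : IsDenomQ K lam s') : s = s' :=
  eq_of_monic_of_associated h.monic h'.monic (associated_of_dvd_dvd
    ((h.polyMul_eq_zero_iff _).1 ((h'.polyMul_eq_zero_iff _).2 dvd_rfl))
    ((h'.polyMul_eq_zero_iff _).1 ((h.polyMul_eq_zero_iff _).2 dvd_rfl)))

theorem IsDenomQ.dvd_of_add {K : Type} [Field K]
    {a b : QT K} {s s₁ s₂ f : K[X]} (h : IsDenomQ K (a + b) s)
    (h₁ : IsDenomQ K a s₁) (h₂ : IsDenomQ K b s₂) (hf₁ : s₁ ∣ f) (hf₂ : s₂ ∣ f) : s ∣ f := by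
  rw [← h.polyMul_eq_zero_iff, map_add, (h₁.polyMul_eq_zero_iff f).2 hf₁,
    (h₂.polyMul_eq_zero_iff f).2 hf₂, add_zero]

theorem IsDenomQ.neg {K : Type} [Field K]
    {a : QT K} {s : K[X]} (h : IsDenomQ K a s) : IsDenomQ K (-a) s := by
  obtain ⟨t, ht⟩ := exists_isDenomQ (-a)
  have key (f : K[X]) : t ∣ f ↔ s ∣ f := by
    rw [← ht.polyMul_eq_zero_iff, ← h.polyMul_eq_zero_iff, map_neg, neg_eq_zero]
  rwa [← eq_of_monic_of_associated ht.monic h.monic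
    (associated_of_dvd_dvd ((key s).2 dvd_rfl) ((key t).1 dvd_rfl))]

theorem finite_ker_polyMul_and_ncard_le {g : Fq[X]} (hg : g ≠ 0) :
    {lam : QT Fq | polyMul g lam = 0}.Finite ∧
      ({lam : QT Fq | polyMul g lam = 0}.ncard : ℝ) ≤ pnorm Fq g := by
  have hg' : algebraMap Fq[X] (RatFunc Fq) g ≠ 0 := RatFunc.algebraMap_ne_zero hg
  have hsub : {lam : QT Fq | polyMul g lam = 0} ⊆
      (fun p => QuotientAddGroup.mk' (polySub Fq) (algebraMap Fq[X] (RatFunc Fq) p /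
        algebraMap Fq[X] (RatFunc Fq) g)) '' (degreeLT Fq g.natDegree : Set Fq[X]) := by
    intro lam hlam
    obtain ⟨μ, rfl⟩ := QuotientAddGroup.mk'_surjective _ lam
    rw [Set.mem_ofPred_eq, polyMul_mk, QuotientAddGroup.mk'_apply,
      QuotientAddGroup.eq_zero_iff] at hlam
    obtain ⟨p, hp⟩ := hlam
    replace hp : algebraMap Fq[X] (RatFunc Fq) p = algebraMap Fq[X] (RatFunc Fq) g * μ := hp
    refine ⟨p % g, ?_, ?_⟩
    · rw [SetLike.mem_coe, mem_degreeLT, ← degree_eq_natDegree hg]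
      exact EuclideanDomain.mod_lt p hg
    · refine (QuotientAddGroup.mk'_eq_mk' _).2
        ⟨algebraMap Fq[X] (RatFunc Fq) (p / g), ⟨p / g, rfl⟩, ?_⟩
      rw [← mul_right_inj' hg', mul_add, mul_div_cancel₀ _ hg', ← hp, ← map_mul, ← map_add,
        EuclideanDomain.mod_add_div]
  have hfin := (finite_degreeLT (Fq := Fq) g.natDegree).image
    (fun p => QuotientAddGroup.mk' (polySub Fq) (algebraMap Fq[X] (RatFunc Fq) p /
        algebraMap Fq[X] (RatFunc Fq) g))
  refine ⟨hfin.subset hsub, ?_⟩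
  have := (Set.ncard_le_ncard hsub hfin).trans (Set.ncard_image_le (finite_degreeLT _))
  rw [ncard_degreeLT] at this
  rw [pnorm, if_neg hg]
  exact_mod_cast this

theorem squarefree_lcm {K : Type} [Field K] {a b : K[X]} (ha : Squarefree a) (hb : Squarefree b) :
    Squarefree (EuclideanDomain.lcm a b) := by
  have h0 : EuclideanDomain.lcm a b ≠ 0 := fun h =>
    (EuclideanDomain.lcm_eq_zero_iff.1 h).elim ha.ne_zero hb.ne_zero
  rw [← isRadical_iff_squarefree_of_ne_zero h0]
  intro n x hx
  exact EuclideanDomain.lcm_dvd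
    (ha.isRadical n x ((EuclideanDomain.dvd_lcm_left a b).trans hx))
    (hb.isRadical n x ((EuclideanDomain.dvd_lcm_right a b).trans hx))

theorem exists_eq_mul_of_dvd_lcm {K : Type} [Field K]
    {s s₁ s₂ : K[X]} (hs : s.Monic) (hs₁ : s₁.Monic)
    (hs₂ : s₂.Monic) (hq₁ : Squarefree s₁) (hq₂ : Squarefree s₂)
    (h : s ∣ EuclideanDomain.lcm s₁ s₂) (h₁ : s₁ ∣ s * s₂) (h₂ : s₂ ∣ s * s₁) :
    ∃ d₁ d₂ e : K[X], d₁.Monic ∧ d₁ ∣ s ∧ d₂.Monic ∧ d₂ ∣ s ∧ e.Monic ∧ s₁ = d₁ * e ∧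
      s₂ = d₂ * e ∧ Associated (EuclideanDomain.lcm s₁ s₂) (s * e) := by
  set L := EuclideanDomain.lcm s₁ s₂
  have hsq : Squarefree L := squarefree_lcm hq₁ hq₂
  set M := L * C L.leadingCoeff⁻¹
  have hMm : M.Monic := monic_mul_leadingCoeff_inv hsq.ne_zero
  have hass : Associated L M := by
    refine associated_mul_unit_right L _ ?_
    simpa using hsq.ne_zero
  have hsqM : Squarefree M := hsq.squarefree_of_dvd hass.symm.dvd
  obtain ⟨e, he⟩ : s ∣ M := h.trans hass.dvd
  have hem : e.Monic := hs.of_mul_monic_left (he ▸ hMm)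
  have hcop : IsRelPrime e s := ((squarefree_mul_iff.1 (he ▸ hsqM)).1).symm
  have hL₁ : L ∣ s * s₁ := EuclideanDomain.lcm_dvd (dvd_mul_left _ _) h₂
  have hL₂ : L ∣ s * s₂ := EuclideanDomain.lcm_dvd h₁ (dvd_mul_left _ _)
  have heM : e ∣ L := (Dvd.intro_left s he.symm).trans hass.symm.dvd
  obtain ⟨d₁, hd₁⟩ : e ∣ s₁ := hcop.dvd_of_dvd_mul_left (heM.trans hL₁)
  obtain ⟨d₂, hd₂⟩ : e ∣ s₂ := hcop.dvd_of_dvd_mul_left (heM.trans hL₂)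
  have hdvd {d t : K[X]} (ht : t = e * d) (htL : t ∣ L) : d ∣ s := by
    have := htL.trans hass.dvd
    rw [he, ht, mul_comm s e] at this
    exact (mul_dvd_mul_iff_left hem.ne_zero).1 this
  exact ⟨d₁, d₂, e, hem.of_mul_monic_left (hd₁ ▸ hs₁), hdvd hd₁ (EuclideanDomain.dvd_lcm_left _ _),
    hem.of_mul_monic_left (hd₂ ▸ hs₂), hdvd hd₂ (EuclideanDomain.dvd_lcm_right _ _), hem,
    by rw [hd₁, mul_comm], by rw [hd₂, mul_comm], he ▸ hass⟩

theorem pnorm_eq_of_associated {f g : Fq[X]} (h : Associated f g) : pnorm Fq f = pnorm Fq g := by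
  simp only [pnorm, natDegree_eq_of_degree_eq (degree_eq_degree_of_associated h), h.eq_zero_iff]

theorem card_fiber_le {lam : QT Fq} {den : QT Fq → Fq[X]} (hden : ∀ mu, IsDenomQ Fq mu (den mu))
    {a b : Fq[X]} (ha : a ≠ 0) (F : Finset (QT Fq))
    (hF : ∀ mu ∈ F, den mu = a ∧ den (lam - mu) = b) :
    (F.card : ℝ) ≤ pnorm Fq (EuclideanDomain.gcd a b) := by
  have hg : EuclideanDomain.gcd a b ≠ 0 := fun h => ha (EuclideanDomain.gcd_eq_zero_iff.1 h).1
  obtain ⟨hfin, hle⟩ := finite_ker_polyMul_and_ncard_le hg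
  obtain rfl | ⟨mu₀, h₀⟩ := F.eq_empty_or_nonempty
  · simpa using (pnorm_pos hg).le
  refine le_trans ?_ hle
  rw [← Set.ncard_coe_finset]
  refine Nat.cast_le.2 (Set.ncard_le_ncard_of_injOn (fun mu => mu - mu₀) (fun mu hmu => ?_)
    (fun x _ y _ h => sub_left_injective h) hfin)
  obtain ⟨h₁, h₂⟩ := hF mu hmu
  obtain ⟨h₁', h₂'⟩ := hF mu₀ h₀
  rw [Set.mem_ofPred_eq]
  obtain ⟨t, ht⟩ := exists_isDenomQ (mu - mu₀)
  refine (ht.polyMul_eq_zero_iff _).2 (EuclideanDomain.dvd_gcd ?_ ?_)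
  · rw [sub_eq_add_neg] at ht
    exact ht.dvd_of_add (hden mu) (hden mu₀).neg h₁.dvd h₁'.dvd
  · rw [show mu - mu₀ = (lam - mu₀) + -(lam - mu) by abel] at ht
    exact ht.dvd_of_add (hden _) (hden _).neg h₂'.dvd h₂.dvd

theorem tauP_rpow_mul_le {d e s : Fq[X]} (hs : s ≠ 0) (hd : d ∣ s) (he : e ≠ 0) {B : ℝ}
    (hB : 0 ≤ B) :
    (tauP Fq (d * e) : ℝ) ^ B ≤ (tauP Fq s : ℝ) ^ B * (tauP Fq e : ℝ) ^ B := by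
  rw [← Real.mul_rpow (Nat.cast_nonneg _) (Nat.cast_nonneg _)]
  refine Real.rpow_le_rpow (Nat.cast_nonneg _) ?_ hB
  exact_mod_cast (tauP_mul_le (ne_zero_of_dvd_ne_zero hs hd) he).trans
    (Nat.mul_le_mul_right _ (tauP_mono hs hd))

theorem sum_tauP_div_pnorm_le {B₁ B₂ : ℝ} (hB₁ : 0 ≤ B₁) (hB₂ : 0 ≤ B₂) {lam : QT Fq} {s : Fq[X]}
    (hs : IsDenomQ Fq lam s) {den : QT Fq → Fq[X]} (hden : ∀ mu, IsDenomQ Fq mu (den mu)) (N : ℕ)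
    (F : Finset (QT Fq)) (hF : ∀ mu ∈ F, Squarefree (den mu) ∧ (den mu).natDegree ≤ N ∧
      Squarefree (den (lam - mu))) :
    ∑ mu ∈ F, (tauP Fq (den mu) : ℝ) ^ B₁ / pnorm Fq (den mu) *
        ((tauP Fq (den (lam - mu)) : ℝ) ^ B₂ / pnorm Fq (den (lam - mu))) ≤
      (tauP Fq s : ℝ) ^ (B₁ + B₂ + 2) / pnorm Fq s *
        ∑ e ∈ monicsLE Fq N, (tauP Fq e : ℝ) ^ (B₁ + B₂) / pnorm Fq e := by
  have hs0 : s ≠ 0 := hs.monic.ne_zero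
  set D := (finite_monic_dvd hs0).toFinset with hD
  have hDcard : (D.card : ℝ) = tauP Fq s := by
    rw [tauP, Set.ncard_eq_toFinset_card _ (finite_monic_dvd hs0)]
  have hex (mu : QT Fq) (hmu : mu ∈ F) : ∃ t : Fq[X] × Fq[X] × Fq[X],
      t ∈ D ×ˢ D ×ˢ monicsLE Fq N ∧ den mu = t.1 * t.2.2 ∧ den (lam - mu) = t.2.1 * t.2.2 ∧
      Associated (EuclideanDomain.lcm (t.1 * t.2.2) (t.2.1 * t.2.2)) (s * t.2.2) := by
    obtain ⟨hq₁, hN, hq₂⟩ := hF mu hmu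
    have h : s ∣ EuclideanDomain.lcm (den mu) (den (lam - mu)) := by
      have hs' := hs
      rw [← add_sub_cancel mu lam] at hs'
      exact hs'.dvd_of_add (hden _) (hden _) (EuclideanDomain.dvd_lcm_left _ _)
        (EuclideanDomain.dvd_lcm_right _ _)
    have h₁ : den mu ∣ s * den (lam - mu) := by
      have h' := hden mu
      rw [show mu = lam + -(lam - mu) by abel] at h'
      have := h'.dvd_of_add hs (hden _).neg (dvd_mul_right _ _) (dvd_mul_left _ _)
      rwa [show lam + -(lam - mu) = mu by abel] at this
    have h₂ : den (lam - mu) ∣ s * den mu := by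
      have h' := hden (lam - mu)
      rw [sub_eq_add_neg] at h'
      have := h'.dvd_of_add hs (hden _).neg (dvd_mul_right _ _) (dvd_mul_left _ _)
      rwa [← sub_eq_add_neg] at this
    obtain ⟨d₁, d₂, e, hm₁, hd₁, hm₂, hd₂, hem, he₁, he₂, hL⟩ := exists_eq_mul_of_dvd_lcm hs.monic
      (hden mu).monic (hden _).monic hq₁ hq₂ h h₁ h₂
    refine ⟨(d₁, d₂, e), ?_, he₁, he₂, by simpa only [← he₁, ← he₂] using hL⟩
    simp only [Finset.mem_product, hD, Set.Finite.mem_toFinset, Set.mem_ofPred_eq, mem_monicsLE]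
    exact ⟨⟨hm₁, hd₁⟩, ⟨hm₂, hd₂⟩, hem,
      (natDegree_le_of_dvd ⟨d₁, by rw [he₁, mul_comm]⟩ hq₁.ne_zero).trans hN⟩
  choose! χ hχ hχ₁ hχ₂ hχL using hex
  rw [← Finset.sum_fiberwise_of_maps_to hχ]
  set T := (tauP Fq s : ℝ)
  have hT : 0 < T := Nat.cast_pos.2 (one_le_tauP hs0)
  have hsp := pnorm_pos hs0
  calc _ ≤ ∑ t ∈ D ×ˢ D ×ˢ monicsLE Fq N, T ^ (B₁ + B₂) / pnorm Fq s *
            ((tauP Fq t.2.2 : ℝ) ^ (B₁ + B₂) / pnorm Fq t.2.2) :=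
          Finset.sum_le_sum fun t ht => ?_
    _ = _ := by
      simp only [Finset.sum_product, Finset.sum_const, nsmul_eq_mul, hDcard, ← Finset.mul_sum]
      rw [Real.rpow_add hT _ 2, Real.rpow_two]
      ring
  obtain ⟨d₁, d₂, e⟩ := t
  simp only [Finset.mem_product, hD, Set.Finite.mem_toFinset, Set.mem_ofPred_eq,
    mem_monicsLE] at ht
  obtain ⟨⟨hm₁, hd₁⟩, ⟨hm₂, hd₂⟩, hem, -⟩ := ht
  have hep := pnorm_pos hem.ne_zero
  have he1 : (0 : ℝ) < tauP Fq e := by exact_mod_cast one_le_tauP hem.ne_zero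
  obtain hemp | ⟨mu₀, h₀⟩ := (F.filter fun mu => χ mu = (d₁, d₂, e)).eq_empty_or_nonempty
  · rw [hemp, Finset.sum_empty]
    positivity
  rw [Finset.mem_filter] at h₀
  have hL := pnorm_eq_of_associated (hχL mu₀ h₀.1)
  rw [h₀.2, pnorm_mul] at hL
  have hfib (mu : QT Fq) (hmu : mu ∈ F.filter fun mu => χ mu = (d₁, d₂, e)) :
      den mu = d₁ * e ∧ den (lam - mu) = d₂ * e := by
    rw [Finset.mem_filter] at hmu
    rw [hχ₁ mu hmu.1, hχ₂ mu hmu.1, hmu.2]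
    exact ⟨rfl, rfl⟩
  have hcard := card_fiber_le hden (mul_ne_zero hm₁.ne_zero hem.ne_zero) _ hfib
  have hp₁ := pnorm_pos (mul_ne_zero hm₁.ne_zero hem.ne_zero)
  have hp₂ := pnorm_pos (mul_ne_zero hm₂.ne_zero hem.ne_zero)
  have hgl : pnorm Fq (EuclideanDomain.gcd (d₁ * e) (d₂ * e)) * (pnorm Fq s * pnorm Fq e) =
      pnorm Fq (d₁ * e) * pnorm Fq (d₂ * e) := by
    rw [← hL, ← pnorm_mul, EuclideanDomain.gcd_mul_lcm, pnorm_mul]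
  refine (Finset.sum_le_card_nsmul _ _ ((tauP Fq (d₁ * e) : ℝ) ^ B₁ / pnorm Fq (d₁ * e) *
    ((tauP Fq (d₂ * e) : ℝ) ^ B₂ / pnorm Fq (d₂ * e))) fun mu hmu => ?_).trans ?_
  · rw [(hfib mu hmu).1, (hfib mu hmu).2]
  · rw [nsmul_eq_mul, div_mul_div_comm, div_mul_div_comm, ← hgl]
    have hg : 0 < pnorm Fq (EuclideanDomain.gcd (d₁ * e) (d₂ * e)) :=
      pos_of_mul_pos_left (hgl ▸ mul_pos hp₁ hp₂) (by positivity)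
    calc _ ≤ pnorm Fq (EuclideanDomain.gcd (d₁ * e) (d₂ * e)) *
          ((T ^ B₁ * (tauP Fq e : ℝ) ^ B₁) * (T ^ B₂ * (tauP Fq e : ℝ) ^ B₂) /
            (pnorm Fq (EuclideanDomain.gcd (d₁ * e) (d₂ * e)) * (pnorm Fq s * pnorm Fq e))) := by
          gcongr
          · exact tauP_rpow_mul_le hs0 hd₁ hem.ne_zero hB₁
          · exact tauP_rpow_mul_le hs0 hd₂ hem.ne_zero hB₂
      _ = _ := by
          rw [Real.rpow_add hT, Real.rpow_add he1]
          field_simp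

variable (Fq)

/-- Products of Ramanujan expansions: the convolution of coefficient functions `c₁, c₂`
supported on fractions with squarefree denominators of degree `≤ X₁` resp. `≤ X₂`, with
`|cᵢ(λ)| ≤ τ(denom λ)^{Bᵢ}/⟨denom λ⟩`, is supported on fractions with squarefree denominators
of degree `≤ X₁ + X₂` and satisfies `|c(λ)| ≤ C·(X₁+1)^A·τ(denom λ)^{B₁+2B₂+3}/⟨denom λ⟩`. -/
theorem convolution_of_ramanujan_coefficients (B₁ B₂ : ℝ) (hB₁ : 0 ≤ B₁) (hB₂ : 0 ≤ B₂) :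
    ∃ C A : ℝ, 0 < C ∧
      ∀ (X₁ X₂ : ℝ), 0 < X₁ → 0 < X₂ →
        ∀ c₁ c₂ : QT Fq → ℂ,
          (∀ lam : QT Fq, c₁ lam ≠ 0 →
            ∃ s : Polynomial Fq, IsDenomQ Fq lam s ∧ Squarefree s ∧ (s.natDegree : ℝ) ≤ X₁) →
          (∀ lam : QT Fq, c₂ lam ≠ 0 →
            ∃ s : Polynomial Fq, IsDenomQ Fq lam s ∧ Squarefree s ∧ (s.natDegree : ℝ) ≤ X₂) →
          (∀ (lam : QT Fq) (s : Polynomial Fq), IsDenomQ Fq lam s →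
            ‖c₁ lam‖ ≤ (tauP Fq s : ℝ) ^ B₁ / pnorm Fq s) →
          (∀ (lam : QT Fq) (s : Polynomial Fq), IsDenomQ Fq lam s →
            ‖c₂ lam‖ ≤ (tauP Fq s : ℝ) ^ B₂ / pnorm Fq s) →
          (∀ lam : QT Fq, (∑ᶠ mu : QT Fq, c₁ mu * c₂ (lam - mu)) ≠ 0 →
            ∃ s : Polynomial Fq, IsDenomQ Fq lam s ∧ Squarefree s ∧
              (s.natDegree : ℝ) ≤ X₁ + X₂) ∧
          (∀ (lam : QT Fq) (s : Polynomial Fq), IsDenomQ Fq lam s →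
            ‖∑ᶠ mu : QT Fq, c₁ mu * c₂ (lam - mu)‖ ≤
              C * (X₁ + 1) ^ A * (tauP Fq s : ℝ) ^ (B₁ + 2 * B₂ + 3) / pnorm Fq s) := by
  set k := ⌈B₁ + B₂⌉₊
  refine ⟨1, (2 ^ k : ℕ), one_pos, ?_⟩
  intro X₁ X₂ hX₁ hX₂ c₁ c₂ hc₁ hc₂ hb₁ hb₂
  choose den hden using exists_isDenomQ (K := Fq)
  have hsupp (lam mu : QT Fq) (h : c₁ mu * c₂ (lam - mu) ≠ 0) :
      (Squarefree (den mu) ∧ ((den mu).natDegree : ℝ) ≤ X₁) ∧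
        Squarefree (den (lam - mu)) ∧ ((den (lam - mu)).natDegree : ℝ) ≤ X₂ := by
    obtain ⟨s₁, h₁, h₁'⟩ := hc₁ mu (left_ne_zero_of_mul h)
    obtain ⟨s₂, h₂, h₂'⟩ := hc₂ (lam - mu) (right_ne_zero_of_mul h)
    rw [(hden mu).unique h₁, (hden (lam - mu)).unique h₂]
    exact ⟨h₁', h₂'⟩
  refine ⟨fun lam hlam => ?_, fun lam s hs => ?_⟩
  · obtain ⟨mu, hmu⟩ : ∃ mu, c₁ mu * c₂ (lam - mu) ≠ 0 := by
      by_contra! h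
      exact hlam (by simp [h])
    obtain ⟨⟨hq₁, hd₁⟩, hq₂, hd₂⟩ := hsupp lam mu hmu
    have hdvd : den lam ∣ EuclideanDomain.lcm (den mu) (den (lam - mu)) := by
      have h := hden lam
      rw [show lam = mu + (lam - mu) by abel] at h
      have := h.dvd_of_add (hden _) (hden _) (EuclideanDomain.dvd_lcm_left _ _)
        (EuclideanDomain.dvd_lcm_right _ _)
      simpa only [add_sub_cancel] using this
    refine ⟨den lam, hden lam, (squarefree_lcm hq₁ hq₂).squarefree_of_dvd hdvd, ?_⟩
    have hle : (den lam).natDegree ≤ (den mu).natDegree + (den (lam - mu)).natDegree := by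
      rw [← natDegree_mul hq₁.ne_zero hq₂.ne_zero]
      exact natDegree_le_of_dvd (hdvd.trans (EuclideanDomain.lcm_dvd (dvd_mul_right _ _)
        (dvd_mul_left _ _))) (mul_ne_zero hq₁.ne_zero hq₂.ne_zero)
    calc ((den lam).natDegree : ℝ) ≤ (den mu).natDegree + (den (lam - mu)).natDegree := by
          exact_mod_cast hle
      _ ≤ X₁ + X₂ := add_le_add hd₁ hd₂
  · have hs0 := hs.monic.ne_zero
    have hsp := pnorm_pos hs0
    have hT : (1 : ℝ) ≤ tauP Fq s := by exact_mod_cast one_le_tauP hs0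
    rw [one_mul, Real.rpow_natCast]
    by_cases hfin : (Function.support fun mu => c₁ mu * c₂ (lam - mu)).Finite
    swap
    · rw [finsum_of_infinite_support hfin, norm_zero]
      positivity
    rw [finsum_eq_sum_of_support_subset _ (s := hfin.toFinset) (by simp)]
    have hsum : ∑ e ∈ monicsLE Fq ⌊X₁⌋₊, (tauP Fq e : ℝ) ^ (B₁ + B₂) / pnorm Fq e ≤
        (X₁ + 1) ^ 2 ^ k := by
      calc _ ≤ ∑ e ∈ monicsLE Fq ⌊X₁⌋₊, (tauP Fq e : ℝ) ^ k / pnorm Fq e := by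
            refine Finset.sum_le_sum fun e he => ?_
            have he0 := (mem_monicsLE.1 he).1.ne_zero
            rw [← Real.rpow_natCast]
            refine div_le_div_of_nonneg_right (Real.rpow_le_rpow_of_exponent_le ?_
              (Nat.le_ceil _)) (pnorm_pos he0).le
            exact_mod_cast one_le_tauP he0
        _ ≤ _ := sum_tauP_pow_div_pnorm_le _ _
        _ ≤ _ := by
            gcongr
            exact Nat.floor_le hX₁.le
    calc _ ≤ ∑ mu ∈ hfin.toFinset, (tauP Fq (den mu) : ℝ) ^ B₁ / pnorm Fq (den mu) *
          ((tauP Fq (den (lam - mu)) : ℝ) ^ B₂ / pnorm Fq (den (lam - mu))) := by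
          refine norm_sum_le_of_le _ fun mu _ => ?_
          rw [norm_mul]
          exact mul_le_mul (hb₁ _ _ (hden _)) (hb₂ _ _ (hden _)) (norm_nonneg _)
            ((norm_nonneg _).trans (hb₁ _ _ (hden _)))
      _ ≤ (tauP Fq s : ℝ) ^ (B₁ + B₂ + 2) / pnorm Fq s *
          ∑ e ∈ monicsLE Fq ⌊X₁⌋₊, (tauP Fq e : ℝ) ^ (B₁ + B₂) / pnorm Fq e := by
          refine sum_tauP_div_pnorm_le hB₁ hB₂ hs hden _ _ fun mu hmu => ?_
          obtain ⟨⟨hq₁, hd₁⟩, hq₂, -⟩ := hsupp lam mu (by simpa using hmu)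
          exact ⟨hq₁, Nat.le_floor hd₁, hq₂⟩
      _ ≤ (tauP Fq s : ℝ) ^ (B₁ + 2 * B₂ + 3) / pnorm Fq s * (X₁ + 1) ^ 2 ^ k := by
          refine mul_le_mul_of_nonneg (div_le_div_of_nonneg_right
            (Real.rpow_le_rpow_of_exponent_le hT (by linarith)) hsp.le) hsum (by positivity)
            (by positivity)
      _ = _ := by ring

end
end
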